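/- Let X be positive definite and μ a probability measure with finite first moment on positive definite matrices, and let β(t) = G(X #_t μ) be the Cartan barycenter of the push-forward X #_t μ. Then β is differentiable at t = 0 with β'(0) = X^{1/2}(∫ log(X^{-1/2} A X^{-1/2}) dμ(A)) X^{1/2}. -/

import Mathlib

open MeasureTheory
open scoped ComplexOrder

abbrev Mat (m : ℕ) := Matrix (Fin m) (Fin m) ℂ

noncomputable instance {m : ℕ} : MeasurableSpace (Mat m) := borel _
instance {m : ℕ} : BorelSpace (Mat m) := ⟨rfl⟩

/-- Functional calculus on Hermitian matrices (junk value `A` otherwise). -/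
noncomputable def matFun {m : ℕ} (f : ℝ → ℝ) (A : Mat m) : Mat m :=
  if h : A.IsHermitian then
    (h.eigenvectorUnitary : Mat m) *
      Matrix.diagonal (fun i => (f (h.eigenvalues i) : ℂ)) *
      star (h.eigenvectorUnitary : Mat m)
  else A

/-- Real power `A^t` of a positive definite matrix, via the spectral decomposition. -/
noncomputable def mpow {m : ℕ} (A : Mat m) (t : ℝ) : Mat m := matFun (fun x => x ^ t) A

/-- Logarithm of a positive definite matrix, via the spectral decomposition. -/
noncomputable def mlog {m : ℕ} (A : Mat m) : Mat m := matFun Real.log A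

/-- The operator norm of a matrix (acting on the Euclidean space). -/
noncomputable def opN {m : ℕ} (A : Mat m) : ℝ :=
  ‖(Matrix.toEuclideanCLM (𝕜 := ℂ) A : EuclideanSpace ℂ (Fin m) →L[ℂ] EuclideanSpace ℂ (Fin m))‖

/-- The Frobenius (Hilbert-Schmidt) norm of a matrix. -/
noncomputable def fnorm {m : ℕ} (A : Mat m) : ℝ :=
  Real.sqrt (∑ i, ∑ j, ‖A i j‖ ^ 2)

/-- The Riemannian trace metric distance `d(A,B) = ‖log (A^{-1/2} B A^{-1/2})‖₂`. -/
noncomputable def rdist {m : ℕ} (A B : Mat m) : ℝ :=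
  fnorm (mlog (mpow A (-(1/2 : ℝ)) * B * mpow A (-(1/2 : ℝ))))

/-- The `t`-weighted geometric mean `X #_t A = X^{1/2} (X^{-1/2} A X^{-1/2})^t X^{1/2}`. -/
noncomputable def geom {m : ℕ} (X : Mat m) (t : ℝ) (A : Mat m) : Mat m :=
  mpow X (1/2 : ℝ) * mpow (mpow X (-(1/2 : ℝ)) * A * mpow X (-(1/2 : ℝ))) t * mpow X (1/2 : ℝ)

/-- Finite first moment for a measure on positive definite matrices. -/
def HasFFM {m : ℕ} (μ : Measure (Mat m)) : Prop :=
  ∃ Y : Mat m, Y.PosDef ∧ Integrable (fun A => rdist A Y) μ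

/-- Couplings of two probability measures. -/
def couplings {m : ℕ} (μ ν : Measure (Mat m)) : Set (Measure (Mat m × Mat m)) :=
  {π | IsProbabilityMeasure π ∧ π.map Prod.fst = μ ∧ π.map Prod.snd = ν}

/-- The 1-Wasserstein distance with respect to the Riemannian trace metric. -/
noncomputable def W1 {m : ℕ} (μ ν : Measure (Mat m)) : ℝ :=
  sInf ((fun π : Measure (Mat m × Mat m) => ∫ p, rdist p.1 p.2 ∂π) '' couplings μ ν)

attribute [local instance] Matrix.frobeniusNormedAddCommGroup Matrix.frobeniusNormedSpace

/-- The left-hand side of the Karcher equation `∫ log (X^{-1/2} A X^{-1/2}) dμ(A)`. -/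
noncomputable def karcherLHS {m : ℕ} (X : Mat m) (μ : Measure (Mat m)) : Mat m :=
  ∫ A, mlog (mpow X (-(1/2 : ℝ)) * A * mpow X (-(1/2 : ℝ))) ∂μ

/-- `G` is the Cartan barycenter map: for every probability measure supported on the
positive definite matrices with finite first moment, `G μ` is the (unique) positive
definite solution of the Karcher equation. -/
def IsCartanBary {m : ℕ} (G : Measure (Mat m) → Mat m) : Prop :=
  ∀ μ : Measure (Mat m), IsProbabilityMeasure μ → (∀ᵐ A ∂μ, A.PosDef) → HasFFM μ →
    (G μ).PosDef ∧ karcherLHS (G μ) μ = 0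

section CStar
open NormedSpace

theorem exp_half_smul_mul_self {A : Type*} [NormedRing A] [NormedAlgebra ℝ A] [CompleteSpace A]
    (a : A) : exp ((1 / 2 : ℝ) • a) * exp ((1 / 2 : ℝ) • a) = exp a := by
  let +nondep : NormedAlgebra ℚ A := .restrictScalars ℚ ℝ A
  rw [← exp_add_of_commute (Commute.refl _), ← add_smul]
  norm_num

variable {A : Type*} [CStarAlgebra A] [PartialOrder A] [StarOrderedRing A]

theorem isStrictlyPositive_exp {a : A} (ha : IsSelfAdjoint a) : IsStrictlyPositive (exp a) := by
  let +nondep : NormedAlgebra ℚ A := .restrictScalars ℚ ℝ A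
  exact IsStrictlyPositive.iff_of_unital.2 ⟨ha.exp_nonneg, isUnit_exp a⟩

theorem norm_le_of_neg_algebraMap_le_of_le_algebraMap {a : A} {r : ℝ}
    (ha : IsSelfAdjoint a) (hr : 0 ≤ r)
    (h₁ : -algebraMap ℝ A r ≤ a) (h₂ : a ≤ algebraMap ℝ A r) : ‖a‖ ≤ r := by
  rw [← cfc_id ℝ a, norm_cfc_le_iff _ _ hr]
  intro x hx
  rw [← map_neg, algebraMap_le_iff_le_spectrum] at h₁
  rw [le_algebraMap_iff_spectrum_le] at h₂
  exact abs_le.2 ⟨h₁ x hx, h₂ x hx⟩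

theorem exp_le_algebraMap_exp_norm {a : A} (ha : IsSelfAdjoint a) :
    exp a ≤ algebraMap ℝ A (Real.exp ‖a‖) := by
  rw [← CFC.real_exp_eq_normedSpace_exp]
  refine cfc_le_algebraMap _ _ _ fun x hx => Real.exp_le_exp.2 ?_
  exact (le_algebraMap_iff_spectrum_le ha).1 ha.le_algebraMap_norm_self x hx

theorem algebraMap_exp_neg_norm_le_exp {a : A} (ha : IsSelfAdjoint a) :
    algebraMap ℝ A (Real.exp (-‖a‖)) ≤ exp a := by
  rw [← CFC.real_exp_eq_normedSpace_exp]
  refine algebraMap_le_cfc _ _ _ fun x hx => Real.exp_le_exp.2 ?_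
  have h := ha.neg_algebraMap_norm_le_self
  rw [← map_neg, algebraMap_le_iff_le_spectrum] at h
  exact h x hx

theorem log_exp_real_mul_exp (r : ℝ) {a : A} (ha : IsSelfAdjoint a) :
    CFC.log (exp ((1 / 2 : ℝ) • a) * algebraMap ℝ A (Real.exp r) * exp ((1 / 2 : ℝ) • a)) =
      algebraMap ℝ A r + a := by
  rw [← Algebra.commutes, mul_assoc, exp_half_smul_mul_self, ← Algebra.smul_def,
    CFC.log_smul' _ (Real.exp_pos r) (isStrictlyPositive_exp ha), Real.log_exp, CFC.log_exp a]

theorem norm_log_conj_exp_sub_le {a b : A} (ha : IsSelfAdjoint a) (hb : IsSelfAdjoint b) :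
    ‖CFC.log (exp ((1 / 2 : ℝ) • a) * exp b * exp ((1 / 2 : ℝ) • a)) - a‖ ≤ ‖b‖ := by
  let +nondep : NormedAlgebra ℚ A := .restrictScalars ℚ ℝ A
  have hs : IsSelfAdjoint ((1 / 2 : ℝ) • a) := (IsSelfAdjoint.all (1 / 2 : ℝ)).smul ha
  have hpos {c : A} (hc : IsStrictlyPositive c) :
      IsStrictlyPositive (exp ((1 / 2 : ℝ) • a) * c * exp ((1 / 2 : ℝ) • a)) := by
    refine IsStrictlyPositive.iff_of_unital.2
      ⟨?_, ((isUnit_exp _).mul hc.isUnit).mul (isUnit_exp _)⟩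
    have h := star_left_conjugate_nonneg hc.nonneg (exp ((1 / 2 : ℝ) • a))
    rwa [hs.exp.star_eq] at h
  have hup := CFC.log_le_log (hs.exp.conjugate_le_conjugate (exp_le_algebraMap_exp_norm hb))
    (hpos (isStrictlyPositive_exp hb))
  have hlo := CFC.log_le_log (hs.exp.conjugate_le_conjugate (algebraMap_exp_neg_norm_le_exp hb))
    (hpos (by
      rw [Real.exp_eq_exp_ℝ, algebraMap_exp_comm]
      exact isStrictlyPositive_exp (.algebraMap A (IsSelfAdjoint.all _))))
  rw [log_exp_real_mul_exp _ ha] at hup hlo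
  refine norm_le_of_neg_algebraMap_le_of_le_algebraMap (IsSelfAdjoint.log.sub ha)
    (norm_nonneg _) ?_ ?_
  · rw [le_sub_iff_add_le, ← map_neg]; exact hlo
  · rw [sub_le_iff_le_add]; exact hup

end CStar

section Banach
open NormedSpace Asymptotics Filter Topology

theorem mul_sub_one_isLittleO {A : Type*} [NormedRing A] {f g a b : ℝ → A}
    (ha : a =O[𝓝 0] fun t : ℝ => t) (hb : b =O[𝓝 0] fun t : ℝ => t)
    (hf : (fun t => f t - 1 - a t) =o[𝓝 0] fun t : ℝ => t)
    (hg : (fun t => g t - 1 - b t) =o[𝓝 0] fun t : ℝ => t) :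
    (fun t => f t * g t - 1 - (a t + b t)) =o[𝓝 0] fun t : ℝ => t := by
  have hid : (fun t : ℝ => t) =o[𝓝 0] fun _ : ℝ => (1 : ℝ) :=
    (isLittleO_one_iff ℝ).2 tendsto_id
  have hf' : (fun t => f t - 1) =O[𝓝 0] fun t : ℝ => t := by
    simpa using hf.isBigO.add ha
  have hg' : (fun t => g t - 1) =O[𝓝 0] fun t : ℝ => t := by
    simpa using hg.isBigO.add hb
  have hfg : (fun t => (f t - 1) * (g t - 1)) =o[𝓝 0] fun t : ℝ => t := by
    simpa using hf'.mul_isLittleO (hg'.trans_isLittleO hid)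
  refine ((hf.add hg).add hfg).congr_left fun t => ?_
  noncomm_ring

variable {A : Type*} [NormedRing A] [NormedAlgebra ℝ A] [CompleteSpace A]

theorem exp_sub_one_sub_isLittleO {f : ℝ → A} (hf : f =O[𝓝 0] fun t : ℝ => t) :
    (fun t => exp (f t) - 1 - f t) =o[𝓝 0] fun t : ℝ => t := by
  have h0 : Tendsto f (𝓝 0) (𝓝 0) := hf.trans_tendsto tendsto_id
  have h := (hasFDerivAt_exp_zero (𝕂 := ℝ) (𝔸 := A)).isLittleO
  have := h.comp_tendsto h0
  simp [Function.comp_def, exp_zero] at this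
  exact this.trans_isBigO hf

theorem sub_sub_smul_isLittleO_of_exp_eq {l a : ℝ → A} {b : A} (hl : l =O[𝓝 0] fun t : ℝ => t)
    (ha : a =O[𝓝 0] fun t : ℝ => t)
    (h : ∀ t, exp (l t) = exp ((1 / 2 : ℝ) • a t) * exp (t • b) * exp ((1 / 2 : ℝ) • a t)) :
    (fun t => l t - a t - t • b) =o[𝓝 0] fun t : ℝ => t := by
  have ha' : (fun t => (1 / 2 : ℝ) • a t) =O[𝓝 0] fun t : ℝ => t := ha.const_smul_left (1 / 2 : ℝ)
  have hb : (fun t : ℝ => t • b) =O[𝓝 0] fun t : ℝ => t := by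
    simpa using (isBigO_refl (fun t : ℝ => t) (𝓝 0)).smul (isBigO_const_const b (one_ne_zero' ℝ) _)
  have h₁ := mul_sub_one_isLittleO ha' hb (exp_sub_one_sub_isLittleO ha')
    (exp_sub_one_sub_isLittleO hb)
  have h₂ := mul_sub_one_isLittleO (ha'.add hb) ha' h₁ (exp_sub_one_sub_isLittleO ha')
  refine (h₂.sub (exp_sub_one_sub_isLittleO hl)).congr_left fun t => ?_
  rw [h]
  module

end Banach

section Integral
open NormedSpace Filter Topology Asymptotics

variable {A : Type*} [NormedRing A] [NormedAlgebra ℝ A] {Ω : Type*} [MeasurableSpace Ω]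
  {μ : Measure Ω}

theorem integral_eq_zero_of_integral_conj_eq_zero {u v : A} (hvu : v * u = 1) {f : Ω → A}
    (h : ∫ ω, u * f ω * v ∂μ = 0) : ∫ ω, f ω ∂μ = 0 := by
  by_cases hf : Integrable f μ
  · have h1 : u * (∫ ω, f ω ∂μ) * v = 0 := by
      rw [← h, integral_mul_const_of_integrable (hf.const_mul u),
        integral_const_mul_of_integrable hf]
    calc ∫ ω, f ω ∂μ = v * u * (∫ ω, f ω ∂μ) * (v * u) := by rw [hvu, one_mul, mul_one]
      _ = v * (u * (∫ ω, f ω ∂μ) * v) * u := by simp only [mul_assoc]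
      _ = 0 := by rw [h1, mul_zero, zero_mul]
  · exact integral_undef hf

theorem hasDerivAt_exp_of_integral_eq_zero [CompleteSpace A] [IsProbabilityMeasure μ]
    {L : ℝ → Ω → A} {K : ℝ → A} {H : Ω → A} {c : ℝ} (hH : Integrable H μ)
    (hL : ∀ t, AEStronglyMeasurable (L t) μ) (hL0 : ∀ t, ∫ ω, L t ω ∂μ = 0)
    (hexp : ∀ᵐ ω ∂μ, ∀ t : ℝ,
      exp (L t ω) = exp ((1 / 2 : ℝ) • -K t) * exp (t • H ω) * exp ((1 / 2 : ℝ) • -K t))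
    (hle : ∀ᵐ ω ∂μ, ∀ t, ‖L t ω + K t‖ ≤ c * ‖t • H ω‖) :
    HasDerivAt (fun t => exp (K t)) (∫ ω, H ω ∂μ) 0 := by
  have hLK : ∀ t, Integrable (fun ω => L t ω + K t) μ := fun t =>
    ((hH.smul t).norm.const_mul c).mono' ((hL t).add aestronglyMeasurable_const)
      (hle.mono fun ω hω => hω t)
  have hLint : ∀ t, Integrable (L t) μ := fun t => by
    simpa [Pi.sub_def] using (hLK t).sub (integrable_const (K t))
  have hK : ∀ t, ∫ ω, (L t ω + K t) ∂μ = K t := fun t => by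
    rw [integral_add (hLint t) (integrable_const _), hL0, zero_add, integral_const]
    simp
  have hKle : ∀ t, ‖K t‖ ≤ (c * ∫ ω, ‖H ω‖ ∂μ) * ‖t‖ := fun t => by
    calc ‖K t‖ = ‖∫ ω, (L t ω + K t) ∂μ‖ := by rw [hK]
      _ ≤ ∫ ω, c * ‖t • H ω‖ ∂μ :=
        norm_integral_le_of_norm_le ((hH.smul t).norm.const_mul c) (hle.mono fun ω hω => hω t)
      _ = _ := by simp_rw [norm_smul, integral_const_mul]; ring
  have hKO : K =O[𝓝 0] (id : ℝ → ℝ) := IsBigO.of_bound _ (Eventually.of_forall hKle)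
  have hK0 : K 0 = 0 := by simpa using hKle 0
  have hlim : ∀ᵐ ω ∂μ, Tendsto (fun t : ℝ => t⁻¹ • (L t ω + K t - t • H ω)) (𝓝[≠] 0) (𝓝 0) := by
    filter_upwards [hexp, hle] with ω hω hω'
    have hLO : (fun t => L t ω) =O[𝓝 0] (id : ℝ → ℝ) := by
      have h1 : (fun t => L t ω + K t) =O[𝓝 0] (id : ℝ → ℝ) :=
        IsBigO.of_bound (c * ‖H ω‖) <| Eventually.of_forall fun t => (hω' t).trans_eq <| by
          rw [norm_smul, id]; ring
      simpa using h1.sub hKO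
    have h2 := sub_sub_smul_isLittleO_of_exp_eq hLO hKO.neg_left hω
    simp only [sub_neg_eq_add] at h2
    exact (h2.mono nhdsWithin_le_nhds).tendsto_inv_smul_nhds_zero
  have hlim_int : Tendsto (fun t : ℝ => ∫ ω, t⁻¹ • (L t ω + K t - t • H ω) ∂μ) (𝓝[≠] 0) (𝓝 0) := by
    rw [← integral_zero Ω A (μ := μ)]
    refine tendsto_integral_filter_of_dominated_convergence (fun ω => c * ‖H ω‖ + ‖H ω‖)
      (Eventually.of_forall fun t => (((hLK t).sub (hH.smul t)).smul t⁻¹).aestronglyMeasurable) ?_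
      ((hH.norm.const_mul c).add hH.norm) hlim
    filter_upwards [self_mem_nhdsWithin] with t ht
    filter_upwards [hle] with ω hω
    have ht' : 0 < ‖t‖ := norm_pos_iff.2 ht
    rw [norm_smul, norm_inv, inv_mul_le_iff₀ ht']
    refine (norm_sub_le _ _).trans ((add_le_add_left (hω t) _).trans_eq ?_)
    rw [norm_smul]
    ring
  have hslope : HasDerivAt K (∫ ω, H ω ∂μ) 0 := by
    rw [hasDerivAt_iff_tendsto_slope_zero]
    have h1 := hlim_int.add_const (∫ ω, H ω ∂μ)
    rw [zero_add] at h1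
    refine h1.congr' ?_
    filter_upwards [self_mem_nhdsWithin] with t ht
    rw [integral_smul, integral_sub (hLK t)
      (show Integrable (fun ω => t • H ω) μ from hH.smul t), hK, integral_smul, smul_sub,
      inv_smul_smul₀ ht, sub_add_cancel, zero_add, hK0, sub_zero]
  have hexp0 : HasFDerivAt (exp : A → A) (1 : A →L[ℝ] A) (K 0) := by
    rw [hK0]
    exact hasFDerivAt_exp_zero
  exact hexp0.comp_hasDerivAt (0 : ℝ) hslope

end Integral

section Matrix
open Matrix NormedSpace
variable {m : ℕ} {A B : Mat m}

theorem matFun_eq_cfc (f : ℝ → ℝ) (hA : A.IsHermitian) : matFun f A = cfc f A := by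
  rw [hA.cfc_eq f, matFun, dif_pos hA, IsHermitian.cfc, Unitary.conjStarAlgAut_apply]
  rfl

theorem mlog_eq_cfc (hA : A.IsHermitian) : mlog A = cfc Real.log A := matFun_eq_cfc _ hA

theorem isHermitian_mlog (hA : A.IsHermitian) : (mlog A).IsHermitian := by
  rw [mlog_eq_cfc hA]
  exact cfc_predicate Real.log A

section L2
open scoped Matrix.Norms.L2Operator MatrixOrder

theorem mlog_eq_log (hA : A.IsHermitian) : mlog A = CFC.log A := mlog_eq_cfc hA

theorem continuous_exp_matrix : Continuous (exp : Mat m → Mat m) := by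
  let +nondep : NormedAlgebra ℚ (Mat m) := .restrictScalars ℚ ℝ (Mat m)
  exact exp_continuous

theorem exp_mlog (hA : A.PosDef) : exp (mlog A) = A := by
  rw [mlog_eq_log hA.isHermitian]
  exact CFC.exp_log A hA.isStrictlyPositive

theorem mlog_exp (hA : A.IsHermitian) : mlog (exp A) = A := by
  rw [mlog_eq_log hA.exp]
  exact CFC.log_exp A hA

theorem posDef_exp (hA : A.IsHermitian) : (exp A).PosDef :=
  (isStrictlyPositive_exp (A := Mat m) hA).posDef

theorem mpow_eq_exp (hA : A.PosDef) (t : ℝ) : mpow A t = exp (t • mlog A) := by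
  have hs : IsSelfAdjoint A := hA.isHermitian
  have hpos : ∀ x ∈ spectrum ℝ A, 0 < x := fun x hx => hA.isStrictlyPositive.spectrum_pos hx
  have hlog : ContinuousOn Real.log (spectrum ℝ A) :=
    Real.continuousOn_log.mono fun x hx => (hpos x hx).ne'
  rw [mpow, matFun_eq_cfc _ hA.isHermitian, mlog_eq_cfc hA.isHermitian,
    ← cfc_const_mul t Real.log A, ← CFC.real_exp_eq_normedSpace_exp (cfc_predicate _ A),
    ← cfc_comp Real.exp (fun x => t * Real.log x) A]
  refine cfc_congr fun x hx => ?_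
  simp [Real.rpow_def_of_pos (hpos x hx), mul_comm]

theorem continuousOn_mlog : ContinuousOn (mlog : Mat m → Mat m) {A | A.PosDef} := by
  have h := CFC.continuousOn_log (A := Mat m)
  refine (h.mono fun A hA => ⟨hA.isHermitian, hA.isUnit⟩).congr
    fun A hA => mlog_eq_log hA.isHermitian

theorem opN_eq_l2_opNorm (A : Mat m) : opN A = ‖A‖ := rfl

theorem opN_mlog_conj_exp_sub_le (hA : A.IsHermitian) (hB : B.IsHermitian) :
    opN (mlog (exp ((1 / 2 : ℝ) • A) * exp B * exp ((1 / 2 : ℝ) • A)) - A) ≤ opN B := by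
  have hs : ((1 / 2 : ℝ) • A).IsHermitian :=
    (IsSelfAdjoint.all (1 / 2 : ℝ)).smul (show IsSelfAdjoint A from hA)
  rw [mlog_eq_log, opN_eq_l2_opNorm, opN_eq_l2_opNorm]
  · exact norm_log_conj_exp_sub_le (A := Mat m) hA hB
  · have h := Matrix.isHermitian_conjTranspose_mul_mul (exp ((1 / 2 : ℝ) • A)) hB.exp
    rwa [hs.exp.eq] at h

end L2

theorem fnorm_eq_norm (A : Mat m) : fnorm A = ‖A‖ := by
  simp [fnorm, frobenius_norm_def, Real.sqrt_eq_rpow]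

theorem exists_norm_equiv_of_linearEquiv {E F : Type*} [NormedAddCommGroup E] [NormedSpace ℂ E]
    [NormedAddCommGroup F] [NormedSpace ℂ F] [FiniteDimensional ℂ E] (e : E ≃ₗ[ℂ] F) :
    ∃ c : ℝ, 0 ≤ c ∧ ∀ x : E, ‖x‖ ≤ c * ‖e x‖ ∧ ‖e x‖ ≤ c * ‖x‖ := by
  let f := e.toContinuousLinearEquiv
  refine ⟨max ‖f.toContinuousLinearMap‖ ‖f.symm.toContinuousLinearMap‖,
    (norm_nonneg _).trans (le_max_left _ _), fun x => ⟨?_, ?_⟩⟩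
  · calc ‖x‖ = ‖f.symm.toContinuousLinearMap (f x)‖ := by simp
      _ ≤ _ := (ContinuousLinearMap.le_opNorm _ _).trans
        (mul_le_mul_of_nonneg_right (le_max_right _ _) (norm_nonneg _))
  · exact (f.toContinuousLinearMap.le_opNorm x).trans
      (mul_le_mul_of_nonneg_right (le_max_left _ _) (norm_nonneg _))

theorem exists_norm_equiv_opN (m : ℕ) :
    ∃ c : ℝ, 0 ≤ c ∧ ∀ A : Mat m, ‖A‖ ≤ c * opN A ∧ opN A ≤ c * ‖A‖ := by
  exact exists_norm_equiv_of_linearEquiv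
    (toEuclideanCLM (𝕜 := ℂ) (n := Fin m)).toAlgEquiv.toLinearEquiv

theorem exists_norm_mlog_conj_exp_sub_le (m : ℕ) :
    ∃ c : ℝ, 0 ≤ c ∧ ∀ A B : Mat m, A.IsHermitian → B.IsHermitian →
      ‖mlog (exp ((1 / 2 : ℝ) • A) * exp B * exp ((1 / 2 : ℝ) • A)) - A‖ ≤ c * ‖B‖ := by
  obtain ⟨c, hc, h⟩ := exists_norm_equiv_opN m
  refine ⟨c * c, mul_nonneg hc hc, fun A B hA hB => ?_⟩
  have h1 := (h _).1.trans (mul_le_mul_of_nonneg_left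
    ((opN_mlog_conj_exp_sub_le hA hB).trans (h B).2) hc)
  exact h1.trans_eq (mul_assoc c c ‖B‖).symm

theorem mpow_half_eq_exp (hA : A.PosDef) : mpow A (1 / 2) = exp ((1 / 2 : ℝ) • mlog A) :=
  mpow_eq_exp hA _

theorem mpow_neg_half_eq_exp (hA : A.PosDef) :
    mpow A (-(1 / 2)) = exp ((1 / 2 : ℝ) • -mlog A) := by
  rw [mpow_eq_exp hA, neg_smul, smul_neg]

theorem posDef_mpow (hA : A.PosDef) (t : ℝ) : (mpow A t).PosDef := by
  rw [mpow_eq_exp hA]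
  exact posDef_exp ((IsSelfAdjoint.all t).smul
    (show IsSelfAdjoint (mlog A) from isHermitian_mlog hA.isHermitian))

theorem posDef_conj_mpow (hA : A.PosDef) (hB : B.PosDef) (t : ℝ) :
    (mpow A t * B * mpow A t).PosDef := by
  have h := hB.conjTranspose_mul_mul_same (B := mpow A t)
    (mulVec_injective_of_isUnit (posDef_mpow hA t).isUnit)
  rwa [(posDef_mpow hA t).isHermitian.eq] at h

theorem mpow_add (hA : A.PosDef) (s t : ℝ) : mpow A s * mpow A t = mpow A (s + t) := by
  rw [mpow_eq_exp hA, mpow_eq_exp hA, mpow_eq_exp hA, add_smul,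
    Matrix.exp_add_of_commute _ _ (((Commute.refl _).smul_left s).smul_right t)]

theorem mpow_zero (hA : A.PosDef) : mpow A 0 = 1 := by
  rw [mpow_eq_exp hA, zero_smul, exp_zero]

theorem mpow_one (hA : A.PosDef) : mpow A 1 = A := by
  rw [mpow_eq_exp hA, one_smul, exp_mlog hA]

theorem mpow_mul_mpow_neg (hA : A.PosDef) (t : ℝ) : mpow A t * mpow A (-t) = 1 := by
  rw [mpow_add hA, add_neg_cancel, mpow_zero hA]

theorem mpow_neg_mul_mpow (hA : A.PosDef) (t : ℝ) : mpow A (-t) * mpow A t = 1 := by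
  rw [mpow_add hA, neg_add_cancel, mpow_zero hA]

theorem mpow_half_mul_self (hA : A.PosDef) : mpow A (1 / 2) * mpow A (1 / 2) = A := by
  rw [mpow_add hA, add_halves, mpow_one hA]

theorem mlog_unitary_conj (hA : A.PosDef) {U : Mat m} (hU : U * Uᴴ = 1) :
    mlog (U * A * Uᴴ) = U * mlog A * Uᴴ := by
  have hinv : U⁻¹ = Uᴴ := inv_eq_right_inv hU
  have hunit : IsUnit U := (isUnit_iff_isUnit_det _).2 (isUnit_det_of_right_inverse hU)
  have h := Matrix.exp_conj U (mlog A) hunit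
  rw [hinv, exp_mlog hA] at h
  rw [← h, mlog_exp (isHermitian_mul_mul_conjTranspose _ (isHermitian_mlog hA.isHermitian))]

theorem continuousOn_mpow (t : ℝ) : ContinuousOn (fun A : Mat m => mpow A t) {A | A.PosDef} := by
  have hexp : Continuous (exp : Mat m → Mat m) := continuous_exp_matrix
  exact (hexp.comp_continuousOn (continuousOn_mlog.const_smul t)).congr fun A hA => mpow_eq_exp hA t

theorem measurableSet_posDef : MeasurableSet {A : Mat m | A.PosDef} := by
  have heq : {A : Mat m | A.PosDef} =
      ({A | Aᴴ = A} ∩ ⋂ x : Fin m → ℂ, {A | 0 ≤ star x ⬝ᵥ A *ᵥ x}) ∩ {A | A.det = 0}ᶜ := by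
    ext A
    refine ⟨fun hA => ⟨⟨hA.isHermitian, Set.mem_iInter.2 hA.posSemidef.dotProduct_mulVec_nonneg⟩,
      hA.posSemidef.posDef_iff_det_ne_zero.1 hA⟩, fun ⟨⟨hA, hx⟩, hdet⟩ => ?_⟩
    have hsemi := posSemidef_iff_dotProduct_mulVec.2 ⟨hA, Set.mem_iInter.1 hx⟩
    exact hsemi.posDef_iff_det_ne_zero.2 hdet
  rw [heq]
  refine (IsClosed.inter ?_ (isClosed_iInter fun x => ?_)).measurableSet.inter
    (IsClosed.measurableSet ?_).compl
  · exact isClosed_eq (by fun_prop) continuous_id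
  · exact isClosed_le continuous_const (by fun_prop)
  · exact isClosed_eq (by fun_prop) continuous_const

section Frobenius

attribute [local instance] Matrix.frobeniusNormedRing Matrix.frobeniusNormedAlgebra

local instance : SecondCountableTopology (Mat m) :=
  inferInstanceAs (SecondCountableTopology (Fin m → Fin m → ℂ))

noncomputable local instance : ContinuousENorm (Mat m) :=
  @SeminormedAddGroup.toContinuousENorm (Mat m) _

theorem exists_norm_mlog_conj_mpow_le (m : ℕ) :
    ∃ c : ℝ, 0 ≤ c ∧ ∀ A B : Mat m, A.PosDef → B.PosDef →
      ‖mlog (mpow A (1 / 2) * B * mpow A (1 / 2)) - mlog A‖ ≤ c * ‖mlog B‖ ∧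
      ‖mlog (mpow A (-(1 / 2)) * B * mpow A (-(1 / 2))) + mlog A‖ ≤ c * ‖mlog B‖ := by
  obtain ⟨c, hc, h⟩ := exists_norm_mlog_conj_exp_sub_le m
  refine ⟨c, hc, fun A B hA hB => ⟨?_, ?_⟩⟩
  · have := h (mlog A) (mlog B) (isHermitian_mlog hA.isHermitian) (isHermitian_mlog hB.isHermitian)
    rwa [exp_mlog hB, ← mpow_half_eq_exp hA] at this
  · have := h (-mlog A) (mlog B) (isHermitian_mlog hA.isHermitian).neg
      (isHermitian_mlog hB.isHermitian)
    rwa [exp_mlog hB, ← mpow_neg_half_eq_exp hA, sub_neg_eq_add] at this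

/-- The logarithm `log (X^{-1/2} A X^{-1/2})` of `A` relative to the base point `X`. -/
noncomputable def relLog (X A : Mat m) : Mat m :=
  mlog (mpow X (-(1 / 2)) * A * mpow X (-(1 / 2)))

theorem rdist_eq_norm_relLog (A B : Mat m) : rdist A B = ‖relLog A B‖ := fnorm_eq_norm _

theorem isHermitian_relLog (hA : A.PosDef) (hB : B.PosDef) : (relLog A B).IsHermitian :=
  isHermitian_mlog (posDef_conj_mpow hA hB _).isHermitian

theorem mpow_conj_eq_exp_relLog (hA : A.PosDef) (hB : B.PosDef) (t : ℝ) :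
    mpow (mpow A (-(1 / 2)) * B * mpow A (-(1 / 2))) t = exp (t • relLog A B) :=
  mpow_eq_exp (posDef_conj_mpow hA hB _) t

theorem geom_eq (hA : A.PosDef) (hB : B.PosDef) (t : ℝ) :
    geom A t B = mpow A (1 / 2) * exp (t • relLog A B) * mpow A (1 / 2) := by
  rw [geom, mpow_conj_eq_exp_relLog hA hB]

theorem posDef_exp_smul_relLog (hA : A.PosDef) (hB : B.PosDef) (t : ℝ) :
    (exp (t • relLog A B)).PosDef := by
  rw [← mpow_conj_eq_exp_relLog hA hB]
  exact posDef_mpow (posDef_conj_mpow hA hB _) t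

theorem mlog_exp_smul_relLog (hA : A.PosDef) (hB : B.PosDef) (t : ℝ) :
    mlog (exp (t • relLog A B)) = t • relLog A B :=
  mlog_exp ((IsSelfAdjoint.all t).smul
    (show IsSelfAdjoint (relLog A B) from isHermitian_relLog hA hB))

theorem posDef_geom (hA : A.PosDef) (hB : B.PosDef) (t : ℝ) : (geom A t B).PosDef := by
  rw [geom_eq hA hB]
  exact posDef_conj_mpow hA (posDef_exp_smul_relLog hA hB t) _

theorem continuousOn_relLog (X : Mat m) (hX : X.PosDef) :
    ContinuousOn (relLog X) {A | A.PosDef} :=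
  continuousOn_mlog.comp (f := fun A => mpow X (-(1 / 2)) * A * mpow X (-(1 / 2)))
    (by fun_prop) fun _ hA => posDef_conj_mpow hX hA _

theorem continuousOn_relLog_left (B : Mat m) (hB : B.PosDef) :
    ContinuousOn (fun X => relLog X B) {A | A.PosDef} :=
  continuousOn_mlog.comp (f := fun X => mpow X (-(1 / 2)) * B * mpow X (-(1 / 2)))
    (((continuousOn_mpow _).mul continuousOn_const).mul (continuousOn_mpow _))
      fun _ hA => posDef_conj_mpow hA hB _

theorem aestronglyMeasurable_of_continuousOn_posDef {f : Mat m → Mat m}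
    (hf : ContinuousOn f {A | A.PosDef}) {μ : Measure (Mat m)} (hμ : ∀ᵐ A ∂μ, A.PosDef) :
    AEStronglyMeasurable f μ := by
  have h : AEStronglyMeasurable f (μ.restrict {A | A.PosDef}) :=
    hf.aestronglyMeasurable measurableSet_posDef
  rwa [Measure.restrict_eq_self_of_ae_mem (s := {A : Mat m | A.PosDef}) hμ] at h

theorem exists_norm_relLog_le (m : ℕ) :
    ∃ c : ℝ, 0 ≤ c ∧ ∀ A B : Mat m, A.PosDef → B.PosDef →
      ‖relLog A B‖ ≤ ‖mlog A‖ + c * ‖mlog B‖ ∧ ‖mlog A‖ ≤ ‖relLog A B‖ + c * ‖mlog B‖ ∧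
      ‖mlog (mpow A (1 / 2) * B * mpow A (1 / 2))‖ ≤ ‖mlog A‖ + c * ‖mlog B‖ := by
  obtain ⟨c, hc, h⟩ := exists_norm_mlog_conj_mpow_le m
  refine ⟨c, hc, fun A B hA hB => ?_⟩
  obtain ⟨h1, h2⟩ := h A B hA hB
  refine ⟨?_, ?_, ?_⟩
  · have h3 : ‖relLog A B‖ ≤ ‖relLog A B + mlog A‖ + ‖mlog A‖ := norm_le_add_norm_add _ _
    linarith [show ‖relLog A B + mlog A‖ ≤ _ from h2]
  · have h3 : ‖mlog A‖ ≤ ‖mlog A + relLog A B‖ + ‖relLog A B‖ := norm_le_add_norm_add _ _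
    rw [add_comm (mlog A)] at h3
    linarith [show ‖relLog A B + mlog A‖ ≤ _ from h2]
  · linarith [norm_le_norm_add_norm_sub' (mlog (mpow A (1 / 2) * B * mpow A (1 / 2))) (mlog A)]

theorem HasFFM.integrable_relLog {μ : Measure (Mat m)} [IsProbabilityMeasure μ] (h : HasFFM μ)
    (hμ : ∀ᵐ A ∂μ, A.PosDef) {X : Mat m} (hX : X.PosDef) : Integrable (relLog X) μ := by
  obtain ⟨Y, hY, hH⟩ := h
  obtain ⟨c, hc, hle⟩ := exists_norm_relLog_le m
  refine Integrable.mono' (g := fun A => ‖mlog X‖ + c * (rdist A Y + c * ‖mlog Y‖)) ?_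
    (aestronglyMeasurable_of_continuousOn_posDef (continuousOn_relLog X hX) hμ) ?_
  · exact (integrable_const _).add ((hH.add (integrable_const _)).const_mul c)
  · filter_upwards [hμ] with A hA
    rw [rdist_eq_norm_relLog]
    exact (hle X A hX hA).1.trans
      (add_le_add_right (mul_le_mul_of_nonneg_left (hle A Y hA hY).2.1 hc) _)

theorem hasFFM_map_geom {μ : Measure (Mat m)} [IsProbabilityMeasure μ]
    (hμ : ∀ᵐ A ∂μ, A.PosDef) {X : Mat m} (hX : X.PosDef) {t : ℝ} (hmeas : AEMeasurable (geom X t) μ)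
    (hH : Integrable (relLog X) μ) : HasFFM (μ.map (geom X t)) := by
  obtain ⟨c, hc, hle⟩ := exists_norm_relLog_le m
  have hpos : ∀ᵐ A ∂μ.map (geom X t), A.PosDef :=
    (ae_map_iff hmeas measurableSet_posDef).2 (hμ.mono fun A hA => posDef_geom hX hA t)
  refine ⟨1, PosDef.one, ?_⟩
  simp_rw [rdist_eq_norm_relLog]
  refine Integrable.norm ?_
  have hsm := aestronglyMeasurable_of_continuousOn_posDef
    (continuousOn_relLog_left (1 : Mat m) PosDef.one) hpos
  refine (integrable_map_measure hsm hmeas).2 ?_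
  refine Integrable.mono'
    (g := fun A => (‖mlog X‖ + c * (|t| * ‖relLog X A‖)) + c * ‖mlog (1 : Mat m)‖)
    ?_ (hsm.comp_aemeasurable hmeas) ?_
  · exact ((integrable_const _).add ((hH.norm.const_mul _).const_mul c)).add (integrable_const _)
  · filter_upwards [hμ] with A hA
    refine (hle _ _ (posDef_geom hX hA t) PosDef.one).1.trans (add_le_add_left ?_ _)
    rw [geom_eq hX hA]
    refine (hle _ _ hX (posDef_exp_smul_relLog hX hA t)).2.2.trans_eq ?_
    rw [mlog_exp_smul_relLog hX hA, norm_smul, Real.norm_eq_abs]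

theorem exists_unitary_relLog_conj {S W : Mat m} (hS : S.PosDef) (hW : W.PosDef) :
    ∃ U : Mat m, U * Uᴴ = 1 ∧
      ∀ E : Mat m, E.PosDef → relLog (S * W * S) (S * E * S) = U * relLog W E * Uᴴ := by
  have hZ : (S * W * S).PosDef := by
    have h := hW.conjTranspose_mul_mul_same (B := S) (mulVec_injective_of_isUnit hS.isUnit)
    rwa [hS.isHermitian.eq] at h
  set Z := S * W * S with hZdef
  have hU : (mpow Z (-(1 / 2)) * S * mpow W (1 / 2))ᴴ = mpow W (1 / 2) * S * mpow Z (-(1 / 2)) := by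
    rw [conjTranspose_mul, conjTranspose_mul, (posDef_mpow hW _).isHermitian.eq,
      (posDef_mpow hZ _).isHermitian.eq, hS.isHermitian.eq, mul_assoc]
  have hUU : mpow Z (-(1 / 2)) * S * mpow W (1 / 2) *
      (mpow W (1 / 2) * S * mpow Z (-(1 / 2))) = 1 := by
    calc _ = mpow Z (-(1 / 2)) * (S * (mpow W (1 / 2) * mpow W (1 / 2)) * S) *
          mpow Z (-(1 / 2)) := by
          simp only [mul_assoc]
      _ = mpow Z (-(1 / 2)) * mpow Z (1 / 2) * (mpow Z (1 / 2) * mpow Z (-(1 / 2))) := by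
          rw [mpow_half_mul_self hW, ← hZdef]
          nth_rewrite 2 [← mpow_half_mul_self hZ]
          simp only [mul_assoc]
      _ = 1 := by rw [mpow_neg_mul_mpow hZ, mpow_mul_mpow_neg hZ, one_mul]
  refine ⟨mpow Z (-(1 / 2)) * S * mpow W (1 / 2), by rw [hU, hUU], fun E hE => ?_⟩
  rw [relLog, relLog, ← mlog_unitary_conj (posDef_conj_mpow hW hE _) (by rw [hU, hUU]), hU]
  congr 1
  calc _ = mpow Z (-(1 / 2)) * S * 1 * E * 1 * S * mpow Z (-(1 / 2)) := by
        simp only [mul_assoc, mul_one]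
    _ = _ := by
        nth_rewrite 1 [← mpow_mul_mpow_neg hW (1 / 2)]
        rw [← mpow_neg_mul_mpow hW (1 / 2)]
        simp only [mul_assoc]

theorem integral_relLog_exp_eq_zero {μ : Measure (Mat m)} [IsProbabilityMeasure μ]
    (hμ : ∀ᵐ A ∂μ, A.PosDef) {X W : Mat m} (hX : X.PosDef) (hW : W.PosDef) {t : ℝ}
    (hmeas : AEMeasurable (geom X t) μ)
    (h : karcherLHS (mpow X (1 / 2) * W * mpow X (1 / 2)) (μ.map (geom X t)) = 0) :
    ∫ A, relLog W (exp (t • relLog X A)) ∂μ = 0 := by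
  obtain ⟨U, hU, hUrel⟩ := exists_unitary_relLog_conj (posDef_mpow hX (1 / 2)) hW
  have hZ : (mpow X (1 / 2) * W * mpow X (1 / 2)).PosDef := posDef_conj_mpow hX hW _
  have hpos : ∀ᵐ A ∂μ.map (geom X t), A.PosDef :=
    (ae_map_iff hmeas measurableSet_posDef).2 (hμ.mono fun A hA => posDef_geom hX hA t)
  have hmap : ∫ A, relLog (mpow X (1 / 2) * W * mpow X (1 / 2)) (geom X t A) ∂μ = 0 := by
    rw [← h]
    exact (integral_map hmeas
      (aestronglyMeasurable_of_continuousOn_posDef (continuousOn_relLog _ hZ) hpos)).symm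
  refine integral_eq_zero_of_integral_conj_eq_zero (u := U) (v := Uᴴ) (mul_eq_one_comm.1 hU) ?_
  rw [← hmap]
  refine integral_congr_ae ?_
  filter_upwards [hμ] with A hA
  rw [geom_eq hX hA, hUrel _ (posDef_exp_smul_relLog hX hA t)]

theorem hasDerivAt_of_karcherLHS_eq_zero {μ : Measure (Mat m)} [IsProbabilityMeasure μ]
    (hμ : ∀ᵐ A ∂μ, A.PosDef) {X : Mat m} (hX : X.PosDef) (hH : Integrable (relLog X) μ)
    (hmeas : ∀ t : ℝ, AEMeasurable (geom X t) μ) {W : ℝ → Mat m} (hW : ∀ t, (W t).PosDef)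
    (h : ∀ t, karcherLHS (mpow X (1 / 2) * W t * mpow X (1 / 2)) (μ.map (geom X t)) = 0) :
    HasDerivAt W (∫ A, relLog X A ∂μ) 0 := by
  obtain ⟨c, -, hc⟩ := exists_norm_mlog_conj_mpow_le m
  have hexp : (fun t => exp (mlog (W t))) = W := funext fun t => exp_mlog (hW t)
  rw [← hexp]
  refine hasDerivAt_exp_of_integral_eq_zero (μ := μ) (c := c)
    (L := fun t A => relLog (W t) (exp (t • relLog X A))) hH (fun t => ?_)
    (fun t => integral_relLog_exp_eq_zero hμ hX (hW t) (hmeas t) (h t)) ?_ ?_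
  · have hcont : Continuous (exp : Mat m → Mat m) := continuous_exp_matrix
    exact aestronglyMeasurable_of_continuousOn_posDef ((continuousOn_relLog _ (hW t)).comp
      (hcont.comp_continuousOn ((continuousOn_relLog X hX).const_smul t))
      fun A hA => posDef_exp_smul_relLog hX hA t) hμ
  · filter_upwards [hμ] with A hA t
    have h1 : exp (relLog (W t) (exp (t • relLog X A))) =
        exp ((1 / 2 : ℝ) • -mlog (W t)) * exp (t • relLog X A) *
          exp ((1 / 2 : ℝ) • -mlog (W t)) := by
      rw [← mpow_neg_half_eq_exp (hW t), relLog,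
        exp_mlog (posDef_conj_mpow (hW t) (posDef_exp_smul_relLog hX hA t) _)]
    exact h1
  · filter_upwards [hμ] with A hA t
    have h1 := (hc (W t) _ (hW t) (posDef_exp_smul_relLog hX hA t)).2
    rwa [mlog_exp_smul_relLog hX hA] at h1

theorem HasDerivAt.matrix_mul_mul {W : ℝ → Mat m} {W' : Mat m} {t : ℝ} (h : HasDerivAt W W' t)
    (S T : Mat m) : HasDerivAt (fun t => S * W t * T) (S * W' * T) t :=
  HasDerivAt.mul_const (HasDerivAt.const_mul S h) T

theorem IsCartanBary.hasDerivAt_map_geom {G : Measure (Mat m) → Mat m} (hG : IsCartanBary G)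
    {X : Mat m} (hX : X.PosDef) {μ : Measure (Mat m)} [IsProbabilityMeasure μ]
    (hμpos : ∀ᵐ A ∂μ, A.PosDef) (hμffm : HasFFM μ) (hmeas : ∀ t : ℝ, AEMeasurable (geom X t) μ) :
    HasDerivAt (fun t : ℝ => G (μ.map (geom X t)))
      (mpow X (1 / 2) * (∫ A, relLog X A ∂μ) * mpow X (1 / 2)) 0 := by
  have hH : Integrable (relLog X) μ := hμffm.integrable_relLog hμpos hX
  have hG' : ∀ t : ℝ, (G (μ.map (geom X t))).PosDef ∧
      karcherLHS (G (μ.map (geom X t))) (μ.map (geom X t)) = 0 := fun t =>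
    hG _ (Measure.isProbabilityMeasure_map (hmeas t))
      ((ae_map_iff (hmeas t) measurableSet_posDef).2 (hμpos.mono fun A hA => posDef_geom hX hA t))
      (hasFFM_map_geom hμpos hX (hmeas t) hH)
  have hconj : ∀ t : ℝ, G (μ.map (geom X t)) = mpow X (1 / 2) *
      (mpow X (-(1 / 2)) * G (μ.map (geom X t)) * mpow X (-(1 / 2))) * mpow X (1 / 2) := fun t => by
    calc G (μ.map (geom X t)) = (mpow X (1 / 2) * mpow X (-(1 / 2))) * G (μ.map (geom X t)) *
          (mpow X (-(1 / 2)) * mpow X (1 / 2)) := by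
          rw [mpow_mul_mpow_neg hX, mpow_neg_mul_mpow hX, one_mul, mul_one]
      _ = _ := by simp only [mul_assoc]
  have hW := hasDerivAt_of_karcherLHS_eq_zero hμpos hX hH hmeas
    (W := fun t => mpow X (-(1 / 2)) * G (μ.map (geom X t)) * mpow X (-(1 / 2)))
    (fun t => posDef_conj_mpow hX (hG' t).1 _) (fun t => by rw [← hconj]; exact (hG' t).2)
  have hS := hW.matrix_mul_mul (mpow X (1 / 2)) (mpow X (1 / 2))
  rwa [← funext hconj] at hS

end Frobenius

end Matrix

/-- The Cartan barycentric trajectory `β(t) = G(X #_t μ)` is differentiable at `t = 0`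
with `β'(0) = X^{1/2} (∫ log (X^{-1/2} A X^{-1/2}) dμ(A)) X^{1/2}`. -/
theorem stmt17 {m : ℕ} (G : Measure (Mat m) → Mat m) (hG : IsCartanBary G)
    (X : Mat m) (hX : X.PosDef) (μ : Measure (Mat m)) (hμ : IsProbabilityMeasure μ)
    (hμpos : ∀ᵐ A ∂μ, A.PosDef) (hμffm : HasFFM μ)
    (hmeas : ∀ t : ℝ, AEMeasurable (geom X t) μ) :
    HasDerivAt (fun t : ℝ => G (μ.map (geom X t)))
      (mpow X (1/2 : ℝ) *
        (∫ A, mlog (mpow X (-(1/2 : ℝ)) * A * mpow X (-(1/2 : ℝ))) ∂μ) *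
        mpow X (1/2 : ℝ)) 0 :=
  hG.hasDerivAt_map_geom hX hμpos hμffm hmeas
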